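/- The binary trees {T_n} do not admit uniformly bilipschitz embeddings into the diamond graphs {D_n}: for every constant 1 ≤ C < ∞ there exists n ∈ ℕ such that for every m ∈ ℕ there is no bilipschitz embedding of T_n into the unweighted diamond graph D_m with distortion at most C. -/

import Mathlib

noncomputable section

/-- The length of the longest common initial segment of two `{0,1}`-sequences. -/
def lcp : List Bool → List Bool → ℕ
  | a :: s, b :: t => if a = b then lcp s t + 1 else 0
  | _, _ => 0

/-- The tree distance `d(s,t) = |s| + |t| − 2ℓ(s,t)` on finite `{0,1}`-sequences. -/
def treeDist (s t : List Bool) : ℝ :=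
  (s.length : ℝ) + (t.length : ℝ) - 2 * (lcp s t : ℝ)

/-- The binary tree of depth `n`: all `{0,1}`-sequences of length at most `n`. -/
def BinTree (n : ℕ) := {l : List Bool // l.length ≤ n}

/-- Auxiliary relation: a new (subdivision) vertex indexed by an ordered edge `p` is
related to the two endpoints of `p`. -/
def subdivRel {V : Type} (A : V → V → Prop) :
    (V ⊕ {p : V × V // A p.1 p.2}) → (V ⊕ {p : V × V // A p.1 p.2}) → Prop
  | Sum.inl u, Sum.inr p => u = p.1.1 ∨ u = p.1.2
  | _, _ => False

/-- The diamond graphs: `D₀` is a single edge; `Dₙ₊₁` is obtained from `Dₙ` by replacing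
each edge `uv` by a quadrilateral `u, a, v, b`. -/
def DiamondData : ℕ → (V : Type) × SimpleGraph V
  | 0 => ⟨Bool, SimpleGraph.fromRel fun a b => a ≠ b⟩
  | n + 1 =>
    ⟨(DiamondData n).1 ⊕
        {p : (DiamondData n).1 × (DiamondData n).1 // (DiamondData n).2.Adj p.1 p.2},
      SimpleGraph.fromRel (subdivRel (DiamondData n).2.Adj)⟩

/-- The vertex set of the diamond graph `Dₙ`. -/
def DiamondV (n : ℕ) : Type := (DiamondData n).1

/-- The shortest path distance on the unweighted diamond graph `Dₙ`. -/
def diamondDist (n : ℕ) (x y : DiamondV n) : ℝ :=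
  ((DiamondData n).2.dist x y : ℝ)

/-- The diamond graph `Dₙ` on its vertex set. -/
def diamondGraph (n : ℕ) : SimpleGraph (DiamondV n) := (DiamondData n).2

namespace Diamond

/-- The inclusion of the vertices of `Dₙ` into those of `Dₙ₊₁`. -/
def old {n : ℕ} (x : DiamondV n) : DiamondV (n + 1) := Sum.inl x

/-- The vertex of `Dₙ₊₁` created by the ordered edge `(u, v)` of `Dₙ`. -/
def mid {n : ℕ} (u v : DiamondV n) (h : (diamondGraph n).Adj u v) : DiamondV (n + 1) :=
  Sum.inr ⟨(u, v), h⟩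

theorem old_or_mid {n : ℕ} (x : DiamondV (n + 1)) :
    (∃ y, x = old y) ∨ ∃ u v h, x = mid u v h := by
  rcases x with y | ⟨⟨u, v⟩, h⟩
  · exact Or.inl ⟨y, rfl⟩
  · exact Or.inr ⟨u, v, h, rfl⟩

theorem adj_zero {x y : DiamondV 0} : (diamondGraph 0).Adj x y ↔ x ≠ y :=
  ⟨fun h => And.left (b := _ ∨ _) h, fun h => And.intro (b := _ ∨ _) h (Or.inl h)⟩

theorem adj_succ {n : ℕ} {x y : DiamondV (n + 1)} :
    (diamondGraph (n + 1)).Adj x y ↔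
      x ≠ y ∧ (subdivRel (diamondGraph n).Adj x y ∨ subdivRel (diamondGraph n).Adj y x) :=
  Iff.rfl

theorem adj_old_mid {n : ℕ} {w u v : DiamondV n} {h : (diamondGraph n).Adj u v} :
    (diamondGraph (n + 1)).Adj (old w) (mid u v h) ↔ w = u ∨ w = v := by
  rw [adj_succ]
  constructor
  · rintro ⟨-, h | h⟩
    · exact h
    · exact h.elim
  · exact fun h => ⟨fun e => Sum.inl_ne_inr e, Or.inl h⟩

theorem not_adj_old_old {n : ℕ} {x y : DiamondV n} :
    ¬ (diamondGraph (n + 1)).Adj (old x) (old y) := by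
  rw [adj_succ]
  rintro ⟨-, h | h⟩ <;> exact h

theorem not_adj_mid_mid {n : ℕ} {u v u' v' : DiamondV n} {h : (diamondGraph n).Adj u v}
    {h' : (diamondGraph n).Adj u' v'} :
    ¬ (diamondGraph (n + 1)).Adj (mid u v h) (mid u' v' h') := by
  rw [adj_succ]
  rintro ⟨-, h | h⟩ <;> exact h

/-- An induction principle for symmetric properties of the edges of `Dₙ₊₁`. -/
theorem adj_succ_cases {n : ℕ} {P : DiamondV (n + 1) → DiamondV (n + 1) → Prop}
    (hsymm : ∀ x y, P x y → P y x)
    (hl : ∀ u v (h : (diamondGraph n).Adj u v), P (old u) (mid u v h))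
    (hr : ∀ u v (h : (diamondGraph n).Adj u v), P (old v) (mid u v h))
    {x y : DiamondV (n + 1)} (hxy : (diamondGraph (n + 1)).Adj x y) : P x y := by
  have key : ∀ w u v (h : (diamondGraph n).Adj u v),
      (diamondGraph (n + 1)).Adj (old w) (mid u v h) → P (old w) (mid u v h) := by
    intro w u v h hw
    rcases adj_old_mid.1 hw with rfl | rfl
    · exact hl _ _ _
    · exact hr _ _ _
  rcases old_or_mid x with ⟨x, rfl⟩ | ⟨u, v, h, rfl⟩ <;>
    rcases old_or_mid y with ⟨y, rfl⟩ | ⟨u', v', h', rfl⟩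
  · exact (not_adj_old_old hxy).elim
  · exact key _ _ _ _ hxy
  · exact hsymm _ _ (key _ _ _ _ hxy.symm)
  · exact (not_adj_mid_mid hxy).elim

/-- A vertex is new if it was created in the last subdivision step; all vertices of `D₀`
are new. -/
def IsNew : (n : ℕ) → DiamondV n → Prop
  | 0, _ => True
  | _ + 1, x => ∀ y, x ≠ old y

theorem isNew_mid {n : ℕ} {u v : DiamondV n} {h : (diamondGraph n).Adj u v} :
    IsNew (n + 1) (mid u v h) :=
  fun _ e => Sum.inr_ne_inl e

theorem not_isNew_old {n : ℕ} {x : DiamondV n} : ¬ IsNew (n + 1) (old x) :=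
  fun h => h x rfl

theorem not_isNew_iff {n : ℕ} {x : DiamondV (n + 1)} :
    ¬ IsNew (n + 1) x ↔ ∃ y, x = old y := by
  simp [IsNew]

theorem isNew_or_isNew {n : ℕ} {u v : DiamondV n} (h : (diamondGraph n).Adj u v) :
    IsNew n u ∨ IsNew n v := by
  cases n with
  | zero => exact Or.inl trivial
  | succ n =>
    exact adj_succ_cases (P := fun u v => IsNew (n + 1) u ∨ IsNew (n + 1) v)
      (fun _ _ => Or.symm) (fun _ _ _ => Or.inr isNew_mid) (fun _ _ _ => Or.inr isNew_mid) h

theorem not_adj_of_isNew {n : ℕ} {u v : DiamondV (n + 1)} (hu : IsNew (n + 1) u)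
    (hv : IsNew (n + 1) v) : ¬ (diamondGraph (n + 1)).Adj u v := fun h =>
  adj_succ_cases (P := fun u v => ¬ (IsNew (n + 1) u ∧ IsNew (n + 1) v))
    (fun _ _ h h' => h h'.symm) (fun _ _ _ h => not_isNew_old h.1)
    (fun _ _ _ h => not_isNew_old h.1) h ⟨hu, hv⟩

theorem exists_neighbors_of_isNew {n : ℕ} {x : DiamondV n} (hx : IsNew n x) :
    ∃ a b, ∀ y, (diamondGraph n).Adj x y → y = a ∨ y = b := by
  cases n with
  | zero =>
    refine ⟨(!x : Bool), (!x : Bool), fun y h => Or.inl ?_⟩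
    have h' : (x : Bool) ≠ y := adj_zero.1 h
    change (y : Bool) = !(x : Bool)
    exact Bool.eq_not.2 h'.symm
  | succ n =>
    rcases old_or_mid x with ⟨x, rfl⟩ | ⟨u, v, h, rfl⟩
    · exact (not_isNew_old hx).elim
    · refine ⟨old u, old v, fun y hy => ?_⟩
      rcases old_or_mid y with ⟨y, rfl⟩ | ⟨u', v', h', rfl⟩
      · exact (adj_old_mid.1 hy.symm).imp (congrArg old) (congrArg old)
      · exact (not_adj_mid_mid hy).elim

open Classical in
/-- The map `Dₙ₊₁ → Dₙ` fixing old vertices and moving each vertex created by an edge to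
a new endpoint of that edge. -/
def parent {n : ℕ} : DiamondV (n + 1) → DiamondV n
  | Sum.inl x => x
  | Sum.inr p => if IsNew n p.1.1 then p.1.1 else p.1.2

@[simp]
theorem parent_old {n : ℕ} (x : DiamondV n) : parent (old x) = x := rfl

theorem parent_mid_eq {n : ℕ} {u v : DiamondV n} (h : (diamondGraph n).Adj u v) :
    parent (mid u v h) = u ∨ parent (mid u v h) = v := by
  by_cases hu : IsNew n u
  · exact Or.inl (if_pos hu)
  · exact Or.inr (if_neg hu)

theorem isNew_parent_mid {n : ℕ} {u v : DiamondV n} (h : (diamondGraph n).Adj u v) :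
    IsNew n (parent (mid u v h)) := by
  by_cases hu : IsNew n u
  · have e : parent (mid u v h) = u := if_pos hu
    rwa [e]
  · have e : parent (mid u v h) = v := if_neg hu
    rw [e]
    exact (isNew_or_isNew h).resolve_left hu

theorem isNew_parent {n : ℕ} {x : DiamondV (n + 1)} (hx : IsNew (n + 1) x) :
    IsNew n (parent x) := by
  rcases old_or_mid x with ⟨x, rfl⟩ | ⟨u, v, h, rfl⟩
  · exact (not_isNew_old hx).elim
  · exact isNew_parent_mid h

theorem parent_adj {n : ℕ} {x y : DiamondV (n + 1)} (h : (diamondGraph (n + 1)).Adj x y) :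
    parent x = parent y ∨ (diamondGraph n).Adj (parent x) (parent y) := by
  refine adj_succ_cases
    (P := fun x y => parent x = parent y ∨ (diamondGraph n).Adj (parent x) (parent y))
    (fun _ _ h => h.imp Eq.symm fun h => h.symm) (fun u v h => ?_) (fun u v h => ?_) h
  · rcases parent_mid_eq h with e | e <;> rw [e]
    · exact Or.inl rfl
    · exact Or.inr h
  · rcases parent_mid_eq h with e | e <;> rw [e]
    · exact Or.inr h.symm
    · exact Or.inl rfl

theorem exists_walk_old {n : ℕ} {x y : DiamondV n} (p : (diamondGraph n).Walk x y) :
    ∃ q : (diamondGraph (n + 1)).Walk (old x) (old y), q.length = 2 * p.length := by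
  induction p with
  | nil => exact ⟨.nil, rfl⟩
  | @cons u v w h p ih =>
    obtain ⟨q, hq⟩ := ih
    have h₁ : (diamondGraph (n + 1)).Adj (old u) (mid u v h) := adj_old_mid.2 (Or.inl rfl)
    have h₂ : (diamondGraph (n + 1)).Adj (mid u v h) (old v) :=
      (adj_old_mid.2 (Or.inr rfl)).symm
    refine ⟨.cons h₁ (.cons h₂ q), ?_⟩
    simp only [SimpleGraph.Walk.length_cons, hq]
    ring

theorem exists_walk_old_parent {n : ℕ} (x : DiamondV (n + 1)) :
    ∃ q : (diamondGraph (n + 1)).Walk x (old (parent x)), q.length ≤ 1 := by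
  rcases old_or_mid x with ⟨x, rfl⟩ | ⟨u, v, h, rfl⟩
  · exact ⟨.nil, by simp⟩
  · have h' : (diamondGraph (n + 1)).Adj (mid u v h) (old (parent (mid u v h))) :=
      (adj_old_mid.2 (parent_mid_eq h)).symm
    exact ⟨h'.toWalk, by simp⟩

theorem connected (n : ℕ) : (diamondGraph n).Connected := by
  suffices h : (diamondGraph n).Preconnected ∧ Nonempty (DiamondV n) from
    { preconnected := h.1, nonempty := h.2 }
  induction n with
  | zero =>
    refine ⟨fun x y => ?_, ⟨(true : Bool)⟩⟩
    by_cases h : x = y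
    · exact h ▸ SimpleGraph.Reachable.refl _
    · exact (adj_zero.2 h).reachable
  | succ n ih =>
    refine ⟨fun x y => ?_, ih.2.map old⟩
    obtain ⟨p, -⟩ := exists_walk_old_parent x
    obtain ⟨q, -⟩ := exists_walk_old_parent y
    obtain ⟨w⟩ := ih.1 (parent x) (parent y)
    obtain ⟨w', -⟩ := exists_walk_old w
    exact ⟨(p.append w').append q.reverse⟩

theorem dist_le_parent {n : ℕ} (x y : DiamondV (n + 1)) :
    (diamondGraph (n + 1)).dist x y ≤ 2 * (diamondGraph n).dist (parent x) (parent y) + 2 := by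
  obtain ⟨p, hp⟩ := exists_walk_old_parent x
  obtain ⟨q, hq⟩ := exists_walk_old_parent y
  obtain ⟨w, hw⟩ := (connected n).exists_walk_length_eq_dist (parent x) (parent y)
  obtain ⟨w', hw'⟩ := exists_walk_old w
  refine (SimpleGraph.dist_le ((p.append w').append q.reverse)).trans ?_
  simp only [SimpleGraph.Walk.length_append, SimpleGraph.Walk.length_reverse]
  omega

theorem dist_le_dist_add_one {n : ℕ} {u v : DiamondV n} (h : (diamondGraph n).Adj u v)
    (y : DiamondV n) : (diamondGraph n).dist u y ≤ (diamondGraph n).dist v y + 1 := by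
  have h₁ := (connected n).dist_triangle (u := u) (v := v) (w := y)
  rw [SimpleGraph.dist_eq_one_iff_adj.2 h] at h₁
  omega

/-- The distance to the vertex `old y`, computed in `Dₙ`. -/
def distToOld {n : ℕ} (y : DiamondV n) : DiamondV (n + 1) → ℕ
  | Sum.inl x => 2 * (diamondGraph n).dist x y
  | Sum.inr p => (diamondGraph n).dist p.1.1 y + (diamondGraph n).dist p.1.2 y

theorem two_mul_dist_le_dist_old {n : ℕ} (x y : DiamondV n) :
    2 * (diamondGraph n).dist x y ≤ (diamondGraph (n + 1)).dist (old x) (old y) := by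
  have hstep : ∀ u v, (diamondGraph (n + 1)).Adj u v →
      distToOld y u ≤ distToOld y v + 1 ∧ distToOld y v ≤ distToOld y u + 1 := by
    intro u v h
    refine adj_succ_cases (P := fun u v =>
      distToOld y u ≤ distToOld y v + 1 ∧ distToOld y v ≤ distToOld y u + 1)
      (fun _ _ h => h.symm) (fun u v h => ?_) (fun u v h => ?_) h <;>
    · change 2 * (diamondGraph n).dist _ y ≤
          (diamondGraph n).dist u y + (diamondGraph n).dist v y + 1 ∧
        (diamondGraph n).dist u y + (diamondGraph n).dist v y ≤
          2 * (diamondGraph n).dist _ y + 1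
      have h₁ := dist_le_dist_add_one h y
      have h₂ := dist_le_dist_add_one h.symm y
      omega
  have hwalk : ∀ {u v : DiamondV (n + 1)} (p : (diamondGraph (n + 1)).Walk u v),
      distToOld y u ≤ distToOld y v + p.length := by
    intro u v p
    induction p with
    | nil => simp
    | cons h p ih =>
      have := (hstep _ _ h).1
      rw [SimpleGraph.Walk.length_cons]
      omega
  obtain ⟨p, hp⟩ := (connected (n + 1)).exists_walk_length_eq_dist (old x) (old y)
  have h := hwalk p
  have hy : distToOld y (old y) = 0 := by
    change 2 * (diamondGraph n).dist y y = 0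
    simp
  rw [hy, hp, zero_add] at h
  exact h

theorem exists_finset_parent_fiber {n : ℕ} (y : DiamondV n) :
    ∃ s : Finset (DiamondV (n + 1)), s.card ≤ 5 ∧ ∀ x, parent x = y → x ∈ s := by
  classical
  by_cases hy : IsNew n y
  · obtain ⟨a, b, hab⟩ := exists_neighbors_of_isNew hy
    let m : DiamondV n → DiamondV n → DiamondV (n + 1) := fun u v =>
      if h : (diamondGraph n).Adj u v then mid u v h else old y
    refine ⟨{old y, m y a, m y b, m a y, m b y}, Finset.card_le_five, fun x hx => ?_⟩
    rcases old_or_mid x with ⟨x, rfl⟩ | ⟨u, v, h, rfl⟩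
    · simp_all
    · have hm : m u v = mid u v h := dif_pos h
      rw [← hm]
      rcases parent_mid_eq h with e | e
      · obtain rfl : y = u := hx.symm.trans e
        rcases hab v h with rfl | rfl <;> simp
      · obtain rfl : y = v := hx.symm.trans e
        rcases hab u h.symm with rfl | rfl <;> simp
  · refine ⟨{old y}, by simp, fun x hx => ?_⟩
    rcases old_or_mid x with ⟨x, rfl⟩ | ⟨u, v, h, rfl⟩
    · simp_all
    · exact (hy (hx ▸ isNew_parent_mid h)).elim

/-- The `j`-fold iterate of `parent`. -/
def ancestor {n : ℕ} : (j : ℕ) → DiamondV (n + j) → DiamondV n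
  | 0, x => x
  | j + 1, x => ancestor j (parent (n := n + j) x)

theorem ancestor_adj {n : ℕ} (j : ℕ) {x y : DiamondV (n + j)}
    (h : (diamondGraph (n + j)).Adj x y) :
    ancestor j x = ancestor j y ∨ (diamondGraph n).Adj (ancestor j x) (ancestor j y) := by
  induction j with
  | zero => exact Or.inr h
  | succ j ih =>
    rcases parent_adj (n := n + j) h with e | e
    · exact Or.inl (congrArg (ancestor j) e)
    · exact ih e

theorem isNew_ancestor {n : ℕ} (j : ℕ) {x : DiamondV (n + j)} (h : IsNew (n + j) x) :
    IsNew n (ancestor j x) := by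
  induction j with
  | zero => exact h
  | succ j ih => exact ih (isNew_parent (n := n + j) h)

theorem exists_finset_ancestor_fiber {n : ℕ} (j : ℕ) (y : DiamondV n) :
    ∃ s : Finset (DiamondV (n + j)), s.card ≤ 5 ^ j ∧ ∀ x, ancestor j x = y → x ∈ s := by
  classical
  induction j with
  | zero => exact ⟨{y}, by simp, fun x hx => Finset.mem_singleton.2 hx⟩
  | succ j ih =>
    obtain ⟨s, hs, hmem⟩ := ih
    choose t ht htmem using fun z : DiamondV (n + j) => exists_finset_parent_fiber z
    refine ⟨s.biUnion t, ?_, fun x hx => ?_⟩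
    · calc (s.biUnion t).card ≤ s.card * 5 := Finset.card_biUnion_le_card_mul _ _ _ fun z _ => ht z
        _ ≤ 5 ^ (j + 1) := by rw [pow_succ]; gcongr
    · exact Finset.mem_biUnion.2 ⟨_, hmem _ hx, htmem _ _ rfl⟩

/-- A fiber of `ancestor` is covered by at most `5 ^ i` sets of small diameter. -/
theorem exists_net (n i j : ℕ) :
    ∃ c : DiamondV (n + (i + j)) → DiamondV (n + i),
      (∀ y, ∃ s : Finset (DiamondV (n + i)), s.card ≤ 5 ^ i ∧
        ∀ x, ancestor (i + j) x = y → c x ∈ s) ∧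
      ∀ x y, c x = c y → (diamondGraph (n + (i + j))).dist x y + 2 ≤ 2 * 2 ^ j := by
  induction j with
  | zero =>
    refine ⟨id, exists_finset_ancestor_fiber i, fun x y h => ?_⟩
    obtain rfl : x = y := h
    simp
  | succ j ih =>
    obtain ⟨c, hc, hd⟩ := ih
    refine ⟨fun x => c (parent (n := n + (i + j)) x), fun y => ?_, fun x y h => ?_⟩
    · obtain ⟨s, hs, hmem⟩ := hc y
      exact ⟨s, hs, fun x hx => hmem _ hx⟩
    · have h₁ := dist_le_parent (n := n + (i + j)) x y
      have h₂ := hd _ _ h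
      change (diamondGraph (n + (i + j) + 1)).dist x y + 2 ≤ _
      rw [pow_succ]
      omega

theorem dist_add_two_le (n : ℕ) (x y : DiamondV n) :
    (diamondGraph n).dist x y + 2 ≤ 3 * 2 ^ n := by
  induction n with
  | zero =>
    by_cases h : x = y
    · subst h
      simp
    · rw [SimpleGraph.dist_eq_one_iff_adj.2 (adj_zero.2 h)]
      norm_num
  | succ n ih =>
    have h₁ := dist_le_parent x y
    have h₂ := ih (parent x) (parent y)
    rw [pow_succ]
    omega

/-- Preimages of non-new vertices under `ancestor` are well separated. -/
theorem two_pow_mul_dist_ancestor_le {n : ℕ} (j : ℕ) {x y : DiamondV (n + j)}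
    (hx : ¬ IsNew n (ancestor j x)) (hy : ¬ IsNew n (ancestor j y)) :
    2 ^ j * (diamondGraph n).dist (ancestor j x) (ancestor j y) ≤
        (diamondGraph (n + j)).dist x y ∧
      (ancestor j x = ancestor j y → x = y) := by
  induction j with
  | zero => exact ⟨by simp [ancestor], id⟩
  | succ j ih =>
    have hold : ∀ z : DiamondV (n + j + 1), ¬ IsNew n (ancestor j (parent z)) →
        z = old (parent z) := by
      intro z hz
      rcases old_or_mid z with ⟨z, rfl⟩ | ⟨u, v, h, rfl⟩
      · rfl
      · exact (hz (isNew_ancestor j (isNew_parent_mid h))).elim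
    obtain ⟨h₁, h₂⟩ := ih hx hy
    have h₃ := two_mul_dist_le_dist_old (parent (n := n + j) x) (parent (n := n + j) y)
    rw [← hold x hx, ← hold y hy] at h₃
    constructor
    · rw [pow_succ]
      change 2 ^ j * 2 * (diamondGraph n).dist (ancestor j (parent (n := n + j) x))
        (ancestor j (parent (n := n + j) y)) ≤ (diamondGraph (n + j + 1)).dist x y
      nlinarith
    · intro e
      rw [hold x hx, hold y hy, h₂ e]

theorem two_pow_le_dist_of_not_isNew {k : ℕ} (j : ℕ) {x y : DiamondV (k + 1 + j)}
    (hx : ¬ IsNew (k + 1) (ancestor j x)) (hy : ¬ IsNew (k + 1) (ancestor j y)) (hxy : x ≠ y) :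
    2 ^ (j + 1) ≤ (diamondGraph (k + 1 + j)).dist x y := by
  obtain ⟨h₁, h₂⟩ := two_pow_mul_dist_ancestor_le j hx hy
  obtain ⟨z, hz⟩ := not_isNew_iff.1 hx
  obtain ⟨w, hw⟩ := not_isNew_iff.1 hy
  have hzw : z ≠ w := by
    rintro rfl
    exact hxy (h₂ (hz.trans hw.symm))
  have h₃ := (connected k).pos_dist_of_ne hzw
  have h₄ := two_mul_dist_le_dist_old z w
  rw [hz, hw] at h₁
  refine le_trans ?_ h₁
  rw [pow_succ]
  gcongr
  omega

/-- A path joining two different components of the complement of the vertices of `Dₖ` meets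
a vertex of `Dₖ`. -/
theorem exists_not_isNew_ancestor {k : ℕ} (j : ℕ) {x y : DiamondV (k + 1 + j)}
    (hx : IsNew (k + 1) (ancestor j x)) (hxy : ancestor j x ≠ ancestor j y) :
    ∃ z, ¬ IsNew (k + 1) (ancestor j z) ∧
      (diamondGraph (k + 1 + j)).dist x z ≤ (diamondGraph (k + 1 + j)).dist x y := by
  obtain ⟨p, hp⟩ := (connected (k + 1 + j)).exists_walk_length_eq_dist x y
  rw [← hp]
  clear hp
  induction p with
  | nil => exact (hxy rfl).elim
  | @cons u v w h p ih =>
    have huv : (diamondGraph (k + 1 + j)).dist u v = 1 := SimpleGraph.dist_eq_one_iff_adj.2 h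
    by_cases hv : IsNew (k + 1) (ancestor j v)
    · have e : ancestor j u = ancestor j v :=
        (ancestor_adj j h).resolve_right (not_adj_of_isNew hx hv)
      obtain ⟨z, hz, hd⟩ := ih hv (e ▸ hxy)
      refine ⟨z, hz, ?_⟩
      have := (connected (k + 1 + j)).dist_triangle (u := u) (v := v) (w := z)
      rw [SimpleGraph.Walk.length_cons]
      omega
    · exact ⟨v, hv, by rw [huv, SimpleGraph.Walk.length_cons]; omega⟩

end Diamond

theorem lcp_append (s w : List Bool) : lcp s (s ++ w) = s.length := by
  induction s with
  | nil => cases w <;> simp [lcp]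
  | cons a s ih => simp [lcp, ih]

theorem treeDist_append (s w : List Bool) : treeDist s (s ++ w) = w.length := by
  rw [treeDist, lcp_append, List.length_append]
  push_cast
  ring

theorem two_mul_lcp_lt {s t : List Bool} (h : s ≠ t) : 2 * lcp s t + 1 ≤ s.length + t.length := by
  induction s generalizing t with
  | nil =>
    cases t with
    | nil => exact (h rfl).elim
    | cons b t => simp [lcp]
  | cons a s ih =>
    cases t with
    | nil => simp [lcp]
    | cons b t =>
      by_cases hab : a = b
      · subst hab
        have := ih (t := t) fun e => h (e ▸ rfl)
        simp only [lcp, if_true, List.length_cons]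
        omega
      · simp only [lcp, if_neg hab, List.length_cons]
        omega

theorem two_le_treeDist {s t : List Bool} (h : s ≠ t) (hl : s.length = t.length) :
    2 ≤ treeDist s t := by
  have h₁ : lcp s t + 1 ≤ t.length := by
    have := two_mul_lcp_lt h
    omega
  have h₂ : (lcp s t : ℝ) + 1 ≤ t.length := mod_cast h₁
  rw [treeDist, hl]
  linarith

namespace Diamond

section Embedding

variable {k i j c N : ℕ} {C r : ℝ} {g : List Bool → DiamondV (k + 1 + (i + j))}

/-- The point `g s` is within distance `r * C` of a vertex of `Dₖ`. -/
def IsNear (C r : ℝ) (g : List Bool → DiamondV (k + 1 + (i + j))) (s : List Bool) : Prop :=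
  ∃ x, ¬ IsNew (k + 1) (ancestor (i + j) x) ∧
    ((diamondGraph (k + 1 + (i + j))).dist (g s) x : ℝ) ≤ r * C

/-- Two nested sequences both mapped near vertices of `Dₖ` are either close or far apart. -/
theorem length_le_or_lt_of_isNear (hC : 1 ≤ C) (hr : 0 < r) (hc : 2 * C ≤ c)
    (hi : 2 * C * (c + 3 + 3 * i) ≤ 2 ^ i) (hj : r + 2 < 2 * 2 ^ (j + 1))
    (hg : ∀ s t : List Bool, s.length ≤ N → t.length ≤ N →
      r * treeDist s t ≤ ((diamondGraph (k + 1 + (i + j))).dist (g s) (g t) : ℝ) ∧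
        ((diamondGraph (k + 1 + (i + j))).dist (g s) (g t) : ℝ) ≤ r * C * treeDist s t)
    {s w : List Bool} (hN : (s ++ w).length ≤ N) (hs : IsNear C r g s)
    (hw : IsNear C r g (s ++ w)) : w.length ≤ c ∨ c + 1 + 3 * i < w.length := by
  obtain ⟨x, hx, hsx⟩ := hs
  obtain ⟨y, hy, hwy⟩ := hw
  have hconn := connected (k + 1 + (i + j))
  obtain ⟨h₁, h₂⟩ := hg s (s ++ w) (by rw [List.length_append] at hN; omega) hN
  rw [treeDist_append] at h₁ h₂
  by_cases hxy : x = y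
  · left
    subst hxy
    have h₃ := hconn.dist_triangle (u := g s) (v := x) (w := g (s ++ w))
    rw [SimpleGraph.dist_comm (u := x)] at h₃
    have h₄ : ((diamondGraph (k + 1 + (i + j))).dist (g s) (g (s ++ w)) : ℝ) ≤
        (diamondGraph (k + 1 + (i + j))).dist (g s) x +
          (diamondGraph (k + 1 + (i + j))).dist (g (s ++ w)) x := mod_cast h₃
    have h₅ : r * w.length ≤ r * c := by nlinarith
    exact_mod_cast le_of_mul_le_mul_left h₅ hr
  · right
    by_contra! hlt
    have h₃ : (diamondGraph (k + 1 + (i + j))).dist x y ≤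
        (diamondGraph (k + 1 + (i + j))).dist (g s) x +
          (diamondGraph (k + 1 + (i + j))).dist (g s) (g (s ++ w)) +
          (diamondGraph (k + 1 + (i + j))).dist (g (s ++ w)) y := by
      have h₄ := hconn.dist_triangle (u := x) (v := g s) (w := y)
      have h₅ := hconn.dist_triangle (u := g s) (v := g (s ++ w)) (w := y)
      rw [SimpleGraph.dist_comm (u := x) (v := g s)] at h₄
      omega
    have h₄ : (2 : ℝ) ^ (i + j + 1) ≤
        (diamondGraph (k + 1 + (i + j))).dist (g s) x +
          (diamondGraph (k + 1 + (i + j))).dist (g s) (g (s ++ w)) +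
          (diamondGraph (k + 1 + (i + j))).dist (g (s ++ w)) y :=
      mod_cast (two_pow_le_dist_of_not_isNew (i + j) hx hy hxy).trans h₃
    have h₅ : (w.length : ℝ) ≤ c + 1 + 3 * i := mod_cast hlt
    have h₆ : r * C * w.length ≤ r * C * (c + 1 + 3 * i) := by gcongr
    have h₇ : r * (2 * C * (c + 3 + 3 * i)) ≤ r * 2 ^ i := by gcongr
    have h₈ : (2 : ℝ) ^ (i + j + 1) = 2 ^ i * 2 ^ (j + 1) := by rw [add_assoc, pow_add]
    have h₉ : (2 : ℝ) ^ i * r < 2 ^ i * (2 * 2 ^ (j + 1)) := by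
      gcongr
      linarith
    nlinarith

/-- Every subtree of depth `3 * i` contains a point mapped near a vertex of `Dₖ`. -/
theorem exists_isNear (hC : 1 ≤ C) (hr : 0 < r) (hi : 0 < i) (hj : 2 * 2 ^ j ≤ r + 2)
    (hg : ∀ s t : List Bool, s.length ≤ N → t.length ≤ N →
      r * treeDist s t ≤ ((diamondGraph (k + 1 + (i + j))).dist (g s) (g t) : ℝ) ∧
        ((diamondGraph (k + 1 + (i + j))).dist (g s) (g t) : ℝ) ≤ r * C * treeDist s t)
    {t : List Bool} (ht : t.length + 3 * i ≤ N) :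
    ∃ w : List Bool, w.length ≤ 3 * i ∧ IsNear C r g (t ++ w) := by
  by_contra! hfar
  have hconst : ∀ w : List Bool, w.length ≤ 3 * i →
      ancestor (i + j) (g (t ++ w)) = ancestor (i + j) (g t) := by
    intro w
    induction w using List.reverseRecOn with
    | nil => simp
    | append_singleton w b ih =>
      intro hw
      rw [List.length_append, List.length_singleton] at hw
      rw [← ih (by omega)]
      have hnear := hfar w (by omega)
      by_contra hne
      have hnew : IsNew (k + 1) (ancestor (i + j) (g (t ++ w))) := by
        by_contra hnew
        refine hnear ⟨_, hnew, ?_⟩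
        rw [SimpleGraph.dist_self]
        push_cast
        positivity
      obtain ⟨z, hz, hd⟩ := exists_not_isNew_ancestor (i + j) hnew (Ne.symm hne)
      refine hnear ⟨z, hz, (Nat.cast_le.2 hd).trans ?_⟩
      have h := (hg (t ++ w) (t ++ w ++ [b]) (by simp; omega) (by simp; omega)).2
      rw [treeDist_append, List.length_singleton, Nat.cast_one, mul_one] at h
      rwa [← List.append_assoc]
  obtain ⟨q, hq, hdist⟩ := exists_net (k + 1) i j
  obtain ⟨s, hs, hmem⟩ := hq (ancestor (i + j) (g t))
  have hinj : Function.Injective fun v : Fin (3 * i) → Bool => q (g (t ++ List.ofFn v)) := by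
    intro u v huv
    by_contra hne
    have hne' : t ++ List.ofFn u ≠ t ++ List.ofFn v := fun h =>
      hne (List.ofFn_injective (List.append_cancel_left h))
    have h₁ := two_le_treeDist hne' (by simp)
    have h₂ := (hg (t ++ List.ofFn u) (t ++ List.ofFn v) (by simpa using ht)
      (by simpa using ht)).1
    have h₃ : ((diamondGraph (k + 1 + (i + j))).dist (g (t ++ List.ofFn u))
        (g (t ++ List.ofFn v)) : ℝ) + 2 ≤ 2 * 2 ^ j := mod_cast hdist _ _ huv
    nlinarith
  have hcard : (Finset.univ : Finset (Fin (3 * i) → Bool)).card ≤ s.card :=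
    Finset.card_le_card_of_injOn _ (fun v _ => hmem _ (hconst _ (by simp))) hinj.injOn
  rw [Finset.card_univ, Fintype.card_fun, Fintype.card_bool, Fintype.card_fin, pow_mul] at hcard
  have : (5 : ℕ) ^ i < (2 ^ 3) ^ i := Nat.pow_lt_pow_left (by norm_num) hi.ne'
  omega

theorem false_of_bilipschitz (hC : 1 ≤ C) (hr : 0 < r) (hc : 2 * C ≤ c)
    (hi : 2 * C * (c + 3 + 3 * i) ≤ 2 ^ i) (hj : 2 * 2 ^ j ≤ r + 2)
    (hj' : r + 2 < 2 * 2 ^ (j + 1)) (hN : 6 * i + c + 1 ≤ N)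
    (hg : ∀ s t : List Bool, s.length ≤ N → t.length ≤ N →
      r * treeDist s t ≤ ((diamondGraph (k + 1 + (i + j))).dist (g s) (g t) : ℝ) ∧
        ((diamondGraph (k + 1 + (i + j))).dist (g s) (g t) : ℝ) ≤ r * C * treeDist s t) :
    False := by
  have hi₀ : 0 < i := by
    rcases Nat.eq_zero_or_pos i with rfl | h
    · norm_num at hi
      nlinarith
    · exact h
  obtain ⟨s, hs, hnear⟩ := exists_isNear hC hr hi₀ hj hg (t := []) (by simp; omega)
  obtain ⟨w, hw, hnear'⟩ := exists_isNear hC hr hi₀ hj hg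
    (t := s ++ List.replicate (c + 1) false) (by simp; omega)
  rw [List.append_assoc] at hnear'
  rw [List.nil_append] at hnear
  have h := length_le_or_lt_of_isNear hC hr hc hi hj' hg (by simp; omega) hnear hnear'
  simp only [List.length_append, List.length_replicate] at h
  omega

end Embedding

end Diamond

theorem exists_linear_le_two_pow (a b : ℝ) : ∃ i : ℕ, a * (b + 3 * i) ≤ 2 ^ i := by
  have h₁ := tendsto_pow_const_div_const_pow_of_one_lt 1 (one_lt_two (α := ℝ))
  have h₂ := tendsto_pow_const_div_const_pow_of_one_lt 0 (one_lt_two (α := ℝ))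
  have h₃ := (h₂.const_mul (a * b)).add (h₁.const_mul (3 * a))
  simp only [mul_zero, add_zero] at h₃
  obtain ⟨i, hi⟩ := (h₃.eventually_le_const one_pos).exists
  refine ⟨i, ?_⟩
  have h₄ : (0 : ℝ) < 2 ^ i := by positivity
  have h₅ : (a * (b + 3 * i)) / 2 ^ i ≤ 1 := by
    refine le_trans (le_of_eq ?_) hi
    ring
  rwa [div_le_one h₄] at h₅

/-- Binary trees do not admit uniformly bilipschitz embeddings into diamond graphs. -/
theorem trees_do_not_embed_into_diamonds :
    ∀ C : ℝ, 1 ≤ C → ∃ n : ℕ, ∀ m : ℕ,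
      ¬ ∃ r : ℝ, 0 < r ∧ ∃ f : BinTree n → DiamondV m,
        ∀ u v : BinTree n,
          r * treeDist u.1 v.1 ≤ diamondDist m (f u) (f v) ∧
            diamondDist m (f u) (f v) ≤ r * C * treeDist u.1 v.1 := by
  intro C hC
  obtain ⟨c, hc⟩ := exists_nat_ge (2 * C)
  obtain ⟨i, hi⟩ := exists_linear_le_two_pow (2 * C) (c + 3)
  obtain ⟨M, hM⟩ := exists_nat_gt (3 * 2 ^ i * (3 * C))
  obtain ⟨N, hN⟩ : ∃ N, N = M + (6 * i + c + 1) := ⟨_, rfl⟩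
  refine ⟨N, fun m => ?_⟩
  rintro ⟨r, hr, f, hf⟩
  let g : List Bool → DiamondV m := fun s =>
    if h : s.length ≤ N then f ⟨s, h⟩ else f ⟨[], Nat.zero_le _⟩
  have hg : ∀ s t : List Bool, s.length ≤ N → t.length ≤ N →
      r * treeDist s t ≤ ((diamondGraph m).dist (g s) (g t) : ℝ) ∧
        ((diamondGraph m).dist (g s) (g t) : ℝ) ≤ r * C * treeDist s t := by
    intro s t hs ht
    have hgs : g s = f ⟨s, hs⟩ := dif_pos hs
    have hgt : g t = f ⟨t, ht⟩ := dif_pos ht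
    rw [hgs, hgt]
    exact hf ⟨s, hs⟩ ⟨t, ht⟩
  obtain ⟨j, hj, hj'⟩ := exists_nat_pow_near (x := (r + 2) / 2) (y := 2) (by linarith)
    one_lt_two
  rcases lt_or_ge m (i + j + 1) with hm | hm
  · have h₁ : 1 ≤ r * C := by
      have h := hg [] ([] ++ [true]) (Nat.zero_le _) (by simp; omega)
      rw [treeDist_append, List.length_singleton, Nat.cast_one, mul_one, mul_one] at h
      have h₂ : 0 < (diamondGraph m).dist (g []) (g ([] ++ [true])) := by
        exact_mod_cast hr.trans_le h.1
      exact le_trans (by exact_mod_cast h₂) h.2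
    have h₂ := (hg [] ([] ++ List.replicate N true) (Nat.zero_le _) (by simp)).1
    rw [treeDist_append, List.length_replicate] at h₂
    have h₃ : ((diamondGraph m).dist (g []) (g ([] ++ List.replicate N true)) : ℝ) + 2 ≤
        3 * 2 ^ m := mod_cast Diamond.dist_add_two_le m _ _
    have h₄ : (2 : ℝ) ^ m ≤ 2 ^ i * 2 ^ j := by
      rw [← pow_add]
      exact pow_le_pow_right₀ one_le_two (by omega)
    have h₅ : (2 : ℝ) ^ i * 2 ^ j ≤ 2 ^ i * (r * (3 * C)) := by
      gcongr
      nlinarith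
    have h₆ : (M : ℝ) ≤ N := by
      rw [hN]
      exact_mod_cast Nat.le_add_right _ _
    have h₇ : r * (3 * 2 ^ i * (3 * C)) < r * N := by
      gcongr
      linarith
    nlinarith
  · obtain ⟨k, rfl⟩ := Nat.exists_eq_add_of_le' hm
    have e : k + (i + j + 1) = k + 1 + (i + j) := by omega
    clear_value g
    clear hf f hm
    revert g
    rw [e]
    intro g hg
    exact Diamond.false_of_bilipschitz hC hr hc hi (by linarith) (by linarith) (by omega) hg
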